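/- Let f be a prime with 2×10^20 ≤ f ≤ 2×10^49, let χ be a Dirichlet character modulo f of order 3, and let q₁ < q₂ be the two smallest prime cubic non-residues modulo f (assumed to exist). Suppose q₁ ≥ 379. Then for every complex cube root of unity ω with ω ≠ 1 there exists a positive integer m satisfying χ(m) = ω, gcd(m, q₁q₂) = 1, and m ≤ 14·f^{1/3}·(log f)^{1/2}. -/

import Mathlib

section stepanov_part
open Polynomial

noncomputable def stepT {F : Type*} [Field F] (G : F[X]) (c : ℕ) : ℕ → (F[X] →ₗ[F] F[X])
  | 0 => LinearMap.id
  | (l + 1) => (LinearMap.mulLeft F G) ∘ₗ derivative ∘ₗ (stepT G c l)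
      + (LinearMap.mulLeft F (C ((c - l : ℕ) : F) * derivative G)) ∘ₗ (stepT G c l)

lemma stepT_succ {F : Type*} [Field F] (G : F[X]) (c l : ℕ) (P : F[X]) :
    stepT G c (l + 1) P = G * derivative (stepT G c l P)
      + C ((c - l : ℕ) : F) * derivative G * stepT G c l P := by
  simp [stepT, mul_assoc]

lemma stepT_deriv {F : Type*} [Field F] (G : F[X]) (c l : ℕ) (P Z : F[X]) (hZ : derivative Z = 0)
    (hl : l ≤ c) : derivative^[l] (G ^ c * P * Z) = G ^ (c - l) * stepT G c l P * Z := by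
  induction l with
  | zero => simp [stepT]
  | succ l ih =>
    rw [Function.iterate_succ_apply', ih (by omega), stepT_succ]
    obtain ⟨d, hd⟩ : ∃ d, c - l = d + 1 := ⟨c - l - 1, by omega⟩
    have h2 : c - (l + 1) = d := by omega
    rw [h2, hd]
    simp only [derivative_mul, derivative_pow_succ, hZ]
    push_cast
    simp only [C_add, C_1, C_eq_natCast]
    ring

lemma stepT_natDegree {F : Type*} [Field F] (G : F[X]) (hG : G.natDegree ≤ 9) (c l : ℕ) (P : F[X]) :
    (stepT G c l P).natDegree ≤ P.natDegree + 9 * l := by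
  induction l with
  | zero => simp [stepT]
  | succ l ih =>
    rw [stepT_succ]
    have hG' : (derivative G).natDegree ≤ 9 := (natDegree_derivative_le G).trans (by omega)
    have h1 : (derivative (stepT G c l P)).natDegree ≤ P.natDegree + 9 * l :=
      (natDegree_derivative_le _).trans (by omega)
    refine (natDegree_add_le _ _).trans (max_le ?_ ?_)
    · exact natDegree_mul_le.trans (by omega)
    · refine natDegree_mul_le.trans ?_
      have : (C ((c - l : ℕ) : F) * derivative G).natDegree ≤ 9 :=
        (natDegree_C_mul_le _ _).trans hG'
      omega

/-- existence of auxiliary coefficients -/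
lemma step_exists {F : Type*} [Field F] (G : F[X]) (hG : G.natDegree ≤ 9) (r : F) (J L D E : ℕ)
    (hcount : L * (D + J + 9 * L) < 3 * J * D) :
    ∃ P : Fin 3 × Fin J → F[X], (∀ a, (P a).degree < D) ∧ P ≠ 0 ∧
      ∀ l < L, ∑ a, stepT G (L + a.1 * E) l (P a) * (X - C r) ^ (a.2 : ℕ) = 0 := by
  set M := D + J + 9 * L with hM
  let Q : ℕ → ((Fin 3 × Fin J → degreeLT F D) →ₗ[F] F[X]) := fun l =>
    ∑ a : Fin 3 × Fin J, (LinearMap.mulRight F ((X - C r) ^ (a.2 : ℕ))) ∘ₗ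
      (stepT G (L + a.1 * E) l) ∘ₗ (degreeLT F D).subtype ∘ₗ (LinearMap.proj a)
  have hQ : ∀ l v, Q l v = ∑ a, stepT G (L + a.1 * E) l (v a : F[X]) * (X - C r) ^ (a.2 : ℕ) := by
    intro l v; simp [Q]
  let Φ : (Fin 3 × Fin J → degreeLT F D) →ₗ[F] (Fin L × Fin M → F) :=
    LinearMap.pi fun lk => (lcoeff F lk.2) ∘ₗ (Q lk.1)
  have hfin : Module.finrank F (degreeLT F D) = D := by
    rw [LinearEquiv.finrank_eq (degreeLTEquiv F D)]; simp
  have : Module.Finite F (degreeLT F D) := Module.Finite.equiv (degreeLTEquiv F D).symm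
  have hker : LinearMap.ker Φ ≠ ⊥ := by
    apply LinearMap.ker_ne_bot_of_finrank_lt
    have hV : Module.finrank F (Fin 3 × Fin J → degreeLT F D) = 3 * J * D := by
      rw [Module.finrank_pi_fintype]
      simp [hfin]
    rw [hV]
    simpa using hcount
  obtain ⟨v, hv, hv0⟩ := (Submodule.ne_bot_iff _).1 hker
  refine ⟨fun a => (v a : F[X]), fun a => mem_degreeLT.1 (v a).2, ?_, ?_⟩
  · intro h
    apply hv0
    funext a
    exact Subtype.ext (congrFun h a)
  · intro l hl
    rw [← hQ]
    by_cases hD : D = 0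
    · subst hD; simp at hcount
    have hdeg : (Q l v).natDegree < M := by
      rw [hQ]
      refine lt_of_le_of_lt (natDegree_sum_le_of_forall_le (n := D - 1 + 9 * l + J) _ _ ?_) (by omega)
      intro a _
      have h1 : (v a : F[X]).natDegree ≤ D - 1 := by
        have h0 := mem_degreeLT.1 (v a).2
        by_cases hz : (v a : F[X]) = 0
        · simp [hz]
        have := (natDegree_lt_iff_degree_lt hz).2 h0
        omega
      have h2 := stepT_natDegree G hG (L + a.1 * E) l (v a : F[X])
      have h3 : ((X - C r) ^ (a.2 : ℕ)).natDegree = (a.2 : ℕ) := by simp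
      have := a.2.2
      refine natDegree_mul_le.trans ?_
      omega
    ext k
    rw [coeff_zero]
    by_cases hk : k < M
    · have := congrFun (LinearMap.mem_ker.1 hv) (⟨l, hl⟩, ⟨k, hk⟩)
      simpa [Φ] using this
    · exact coeff_eq_zero_of_natDegree_lt (by omega)


lemma sum_ne_zero_of_rootMult {F : Type*} [Field F] {ι : Type*} [Fintype ι] [DecidableEq ι] (r : F)
    (u : ι → F[X]) (hne : ∃ a, u a ≠ 0)
    (hinj : ∀ a b, u a ≠ 0 → u b ≠ 0 → rootMultiplicity r (u a) = rootMultiplicity r (u b) → a = b) :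
    ∑ a, u a ≠ 0 := by
  classical
  intro hsum
  obtain ⟨a₀, ha₀⟩ := hne
  obtain ⟨a, ha, hmin⟩ := Finset.exists_min_image (Finset.univ.filter fun a => u a ≠ 0)
    (fun a => rootMultiplicity r (u a)) ⟨a₀, by simp [ha₀]⟩
  simp only [Finset.mem_filter, Finset.mem_univ, true_and] at ha hmin
  rw [← Finset.add_sum_erase _ _ (Finset.mem_univ a)] at hsum
  have hd : (X - C r) ^ (rootMultiplicity r (u a) + 1) ∣ ∑ b ∈ Finset.univ.erase a, u b := by
    apply Finset.dvd_sum
    intro b hb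
    by_cases hb0 : u b = 0
    · simp [hb0]
    rw [← le_rootMultiplicity_iff hb0]
    rcases lt_or_eq_of_le (hmin b hb0) with h | h
    · exact h
    · exact absurd (hinj a b ha hb0 h) (Finset.ne_of_mem_erase hb).symm
  have hd2 : (X - C r) ^ (rootMultiplicity r (u a) + 1) ∣ u a := by
    refine (dvd_add_left hd).1 ?_
    rw [hsum]
    exact dvd_zero _
  rw [← le_rootMultiplicity_iff ha] at hd2
  omega

lemma step_distinct (q E m : ℕ) (hq : q = 3 * E + 1) (hE : 30 ≤ E) (hm : m ≤ 9) (hm3 : ¬ 3 ∣ m)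
    (i i' : Fin 3) (j j' p p' : ℕ) (L : ℕ) (hp : p < E - 20) (hp' : p' < E - 20)
    (h : m * (L + i * E) + p + q * j = m * (L + i' * E) + p' + q * j') : i = i' ∧ j = j' := by
  have key : (q : ℤ) * (m * (i : ℕ) + 3 * j - m * (i' : ℕ) - 3 * j')
      = m * ((i : ℕ) - (i' : ℕ)) - 3 * (p - p') := by
    have h' : (m : ℤ) * (L + (i : ℕ) * E) + p + q * j = m * (L + (i' : ℕ) * E) + p' + q * j' := by
      exact_mod_cast h
    have hq' : (q : ℤ) = 3 * E + 1 := by exact_mod_cast hq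
    rw [hq'] at h' ⊢
    linear_combination 3 * h'
  have hi := i.2
  have hi' := i'.2
  have hz : (m : ℤ) * ((i : ℕ) - (i' : ℕ)) - 3 * (p - p') = 0 := by
    apply Int.eq_zero_of_abs_lt_dvd (m := (q : ℤ)) ⟨_, key.symm⟩
    rw [abs_lt]
    generalize (i : ℕ) = a at *
    generalize (i' : ℕ) = a' at *
    clear h key
    constructor <;> interval_cases a <;> interval_cases a' <;> push_cast <;> omega
  have hq0 : (q : ℤ) ≠ 0 := by omega
  rw [hz] at key
  have hz2 := (mul_eq_zero.1 key).resolve_left hq0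
  have hii : (i : ℕ) = i' := by
    generalize (i : ℕ) = a at *
    generalize (i' : ℕ) = a' at *
    clear h key
    interval_cases a <;> interval_cases a' <;> push_cast at hz <;> omega
  refine ⟨Fin.ext hii, ?_⟩
  rw [hii] at hz2
  have : (3 : ℤ) * j = 3 * j' := by linear_combination hz2
  omega

lemma card_mul_le_natDegree {F : Type*} [Field F] [DecidableEq F] (R : F[X]) (hR : R ≠ 0)
    (S : Finset F) (L : ℕ) (hL : 1 ≤ L) (h : ∀ x ∈ S, L ≤ rootMultiplicity x R) :
    S.card * L ≤ R.natDegree := by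
  refine le_trans ?_ (card_roots' R)
  rw [← Multiset.toFinset_sum_count_eq]
  have hsub : S ⊆ R.roots.toFinset := by
    intro x hx
    rw [Multiset.mem_toFinset, ← Multiset.count_pos, count_roots]
    exact lt_of_lt_of_le hL (h x hx)
  refine le_trans ?_ (Finset.sum_le_sum_of_subset hsub)
  rw [← smul_eq_mul]
  apply Finset.card_nsmul_le_sum
  intro x hx
  rw [count_roots]; exact h x hx

lemma step_main (q : ℕ) [Fact q.Prime] (E m J L : ℕ) (hq : q = 3 * E + 1) (hE : 30 ≤ E) (hm : m ≤ 9)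
    (hm3 : ¬ 3 ∣ m) (G G1 : (ZMod q)[X]) (r : ZMod q) (hG : G.natDegree ≤ 9)
    (hGG : G = (X - C r) ^ m * G1) (hG1 : G1.eval r ≠ 0)
    (hL1 : 1 ≤ L) (hLq : L < q)
    (hcount : L * ((E - 20) + J + 9 * L) < 3 * J * (E - 20)) :
    (Finset.univ.filter fun x : ZMod q => (G.eval x) ^ E = 1).card * L ≤ 9 * L + (J + 6) * q := by
  classical
  obtain ⟨P, hPdeg, hP0, hP⟩ := step_exists G hG r J L (E - 20) E hcount
  have hG1ne : G1 ≠ 0 := by rintro rfl; simp at hG1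
  have hGne : G ≠ 0 := by
    rw [hGG]; exact mul_ne_zero (pow_ne_zero _ (X_sub_C_ne_zero r)) hG1ne
  have hPnat : ∀ a, P a ≠ 0 → (P a).natDegree < E - 20 := fun a ha =>
    (natDegree_lt_iff_degree_lt ha).2 (hPdeg a)
  let u : Fin 3 × Fin J → (ZMod q)[X] := fun a =>
    G ^ (L + a.1 * E) * P a * (X - C r) ^ (q * a.2)
  have hu0 : ∀ a, u a ≠ 0 → P a ≠ 0 := by
    intro a ha h; apply ha; simp [u, h]
  have hu0' : ∀ a, P a ≠ 0 → u a ≠ 0 := by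
    intro a ha
    exact mul_ne_zero (mul_ne_zero (pow_ne_zero _ hGne) ha) (pow_ne_zero _ (X_sub_C_ne_zero r))
  have hrmG1 : ∀ c, rootMultiplicity r (G1 ^ c) = 0 := by
    intro c
    apply rootMultiplicity_eq_zero
    simp [IsRoot, hG1]
  have hrm : ∀ a, P a ≠ 0 → rootMultiplicity r (u a)
      = m * (L + a.1 * E) + rootMultiplicity r (P a) + q * a.2 := by
    intro a ha
    have h1 := hu0' a ha
    have h2 : G ^ (L + a.1 * E) * P a ≠ 0 := mul_ne_zero (pow_ne_zero _ hGne) ha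
    have h3 : G ^ (L + a.1 * E) ≠ 0 := pow_ne_zero _ hGne
    simp only [u]
    rw [rootMultiplicity_mul h1, rootMultiplicity_mul h2, rootMultiplicity_X_sub_C_pow]
    congr 2
    rw [hGG, mul_pow, rootMultiplicity_mul (by rw [← mul_pow, ← hGG]; exact h3), ← pow_mul,
      rootMultiplicity_X_sub_C_pow, hrmG1, add_zero]
  have hRne : ∑ a, u a ≠ 0 := by
    apply sum_ne_zero_of_rootMult r
    · obtain ⟨a, ha⟩ := Function.ne_iff.1 hP0
      exact ⟨a, hu0' a ha⟩
    · intro a b ha hb hab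
      have ha' := hu0 a ha
      have hb' := hu0 b hb
      rw [hrm a ha', hrm b hb'] at hab
      have hpa : rootMultiplicity r (P a) < E - 20 :=
        lt_of_le_of_lt ((count_roots (P a) (a := r)).symm.le.trans
          ((Multiset.count_le_card _ _).trans (card_roots' _))) (hPnat a ha')
      have hpb : rootMultiplicity r (P b) < E - 20 :=
        lt_of_le_of_lt ((count_roots (P b) (a := r)).symm.le.trans
          ((Multiset.count_le_card _ _).trans (card_roots' _))) (hPnat b hb')
      have := step_distinct q E m hq hE hm hm3 a.1 b.1 a.2 b.2 _ _ L hpa hpb hab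
      exact Prod.ext this.1 (Fin.ext this.2)
  have hdeg : (∑ a, u a).natDegree ≤ 9 * L + (J + 6) * q := by
    apply natDegree_sum_le_of_forall_le
    intro a _
    by_cases ha : P a = 0
    · simp [u, ha]
    have h1 := hPnat a ha
    have h2 : (G ^ (L + a.1 * E)).natDegree ≤ (L + a.1 * E) * 9 :=
      natDegree_pow_le_of_le _ hG
    have h3 : ((X - C r) ^ (q * (a.2 : ℕ))).natDegree = q * a.2 := by simp
    have h4 : (a.1 : ℕ) * E ≤ 2 * E := Nat.mul_le_mul_right _ (by omega)
    have h5 : q * a.2 ≤ q * (J - 1) := Nat.mul_le_mul_left _ (by omega)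
    have h6 : q * (J - 1) + q ≤ q * J := by
      have := a.2.2
      rw [← Nat.mul_succ]; exact Nat.mul_le_mul_left _ (by omega)
    have h7 : (J + 6) * q = q * J + 6 * q := by ring
    refine natDegree_mul_le.trans ?_
    refine (Nat.add_le_add_right natDegree_mul_le _).trans ?_
    rw [h3]
    omega
  refine (card_mul_le_natDegree _ hRne _ L hL1 ?_).trans hdeg
  intro x hx
  have hx1 : (G.eval x) ^ E = 1 := by simpa using hx
  have : L - 1 < rootMultiplicity x (∑ a, u a) := by
    apply lt_rootMultiplicity_of_isRoot_iterate_derivative_of_mem_nonZeroDivisors' hRne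
    · intro l hl
      have hl' : l < L := by omega
      rw [IsRoot, iterate_derivative_sum, eval_finsetSum]
      have hterm : ∀ a, eval x (derivative^[l] (u a))
          = (G.eval x) ^ (L - l) * eval x (stepT G (L + a.1 * E) l (P a) * (X - C r) ^ (a.2 : ℕ)) := by
        intro a
        have hZ : derivative ((X - C r : (ZMod q)[X]) ^ (q * (a.2 : ℕ))) = 0 := by
          rw [derivative_pow]; simp
        simp only [u]
        rw [stepT_deriv _ _ _ _ _ hZ (by omega)]
        have e1 : L + a.1 * E - l = (L - l) + E * a.1 := by
          rw [mul_comm E]; omega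
        rw [e1]
        simp only [eval_mul, eval_pow, eval_sub, eval_X, eval_C, pow_add, pow_mul, hx1, one_pow,
          ZMod.pow_card]
        ring
      simp only [hterm]
      rw [← Finset.mul_sum, ← eval_finsetSum, hP l hl']
      simp
    · intro k hk hk0
      apply mem_nonZeroDivisors_of_ne_zero
      rw [Ne, ZMod.natCast_eq_zero_iff]
      intro hd
      have := Nat.le_of_dvd (by omega) hd
      omega
  omega

lemma stepanov (q : ℕ) [Fact q.Prime] (E m : ℕ) (hq : q = 3 * E + 1) (hq20 : 10 ^ 20 ≤ q) (hm : m ≤ 9)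
    (hm3 : ¬ 3 ∣ m) (G G1 : (ZMod q)[X]) (r : ZMod q) (hG : G.natDegree ≤ 9)
    (hGG : G = (X - C r) ^ m * G1) (hG1 : G1.eval r ≠ 0) :
    ((Finset.univ.filter fun x : ZMod q => (G.eval x) ^ E = 1).card : ℝ) ≤ q / 3 + 20 * √q := by
  set s := Nat.sqrt q with hs
  have hs1 : s * s ≤ q := Nat.sqrt_le q
  have hs2 : q < (s + 1) * (s + 1) := Nat.lt_succ_sqrt q
  have hs3 : 10 ^ 10 ≤ s := by rw [hs, Nat.le_sqrt]; omega
  obtain ⟨K, hK⟩ : ∃ K, s / 6 = K + 3 := ⟨s / 6 - 3, by omega⟩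
  have hJs : 6 * (K + 3) ≤ s := by omega
  have hJs2 : s < 6 * (K + 3) + 6 := by omega
  have h36 : 36 * ((K + 3) * (K + 3)) ≤ q := by
    calc 36 * ((K + 3) * (K + 3)) = (6 * (K + 3)) * (6 * (K + 3)) := by ring
      _ ≤ s * s := Nat.mul_le_mul hJs hJs
      _ ≤ q := hs1
  obtain ⟨D, hD⟩ : ∃ D, E = D + 20 := ⟨E - 20, by omega⟩
  have main := step_main q E m (K + 3) (3 * K) hq (by omega) hm hm3 G G1 r hG hGG hG1 (by omega)
    (by nlinarith) (by
      have : E - 20 = D := by omega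
      rw [this]
      nlinarith)
  set N := (Finset.univ.filter fun x : ZMod q => (G.eval x) ^ E = 1).card
  have main' : (N : ℝ) * (3 * K) ≤ 9 * (3 * K) + (K + 9) * q := by
    have : N * (3 * K) ≤ 9 * (3 * K) + (K + 9) * q := by convert main using 2
    exact_mod_cast this
  set t := √(q : ℝ) with ht
  have htt : t * t = q := Real.mul_self_sqrt (by positivity)
  have ht0 : 0 ≤ t := Real.sqrt_nonneg _
  have ht1 : t < s + 1 := by
    have : (q : ℝ) < (s + 1) * (s + 1) := by exact_mod_cast hs2
    nlinarith
  have hKt : t ≤ 6 * K + 24 := by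
    have : (s : ℝ) + 1 ≤ 6 * (K + 3) + 6 := by exact_mod_cast hJs2
    linarith
  have htbig : (10 : ℝ) ^ 10 ≤ t := by
    apply Real.le_sqrt_of_sq_le
    have : ((10 ^ 20 : ℕ) : ℝ) ≤ q := by exact_mod_cast hq20
    push_cast at this; linarith
  have hK0 : (0 : ℝ) < 3 * K := by linarith
  rw [← htt] at main' ⊢
  by_contra hcon
  push Not at hcon
  have : (t * t / 3 + 20 * t) * (3 * K) < N * (3 * K) := by
    exact mul_lt_mul_of_pos_right hcon hK0
  nlinarith


lemma cube_re {z : ℂ} (h : z ^ 3 = 1) (h1 : z ≠ 1) : z.re = -1 / 2 := by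
  have h2 : z ^ 2 + z + 1 = 0 := by
    have : (z - 1) * (z ^ 2 + z + 1) = 0 := by linear_combination h
    exact (mul_eq_zero.1 this).resolve_left (sub_ne_zero.2 h1)
  have hre := congrArg Complex.re h2
  have him := congrArg Complex.im h2
  simp [pow_two] at hre him
  have h3 : z.im * (2 * z.re + 1) = 0 := by linear_combination him
  rcases mul_eq_zero.1 h3 with h4 | h4
  · rw [h4] at hre; nlinarith [sq_nonneg (z.re + 1 / 2)]
  · linarith

section chi
variable {f : ℕ} [Fact f.Prime] (χ : DirichletCharacter ℂ f)

lemma chi_cube (hχ : orderOf χ = 3) {y : ZMod f} (hy : y ≠ 0) : χ y ^ 3 = 1 := by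
  have h : χ ^ 3 = 1 := by rw [← hχ]; exact pow_orderOf_eq_one χ
  have := congrArg (fun ψ : DirichletCharacter ℂ f => ψ y) h
  simp only [MulChar.pow_apply' χ (by norm_num : (3 : ℕ) ≠ 0)] at this
  rw [this, MulChar.one_apply (isUnit_iff_ne_zero.2 hy)]

lemma chi_conj (hχ : orderOf χ = 3) (y : ZMod f) : (starRingEnd ℂ) (χ y) = χ y ^ 2 := by
  by_cases hy : y = 0
  · subst hy; simp [MulChar.map_nonunit]
  have h3 := chi_cube χ hχ hy
  have hn : ‖χ y‖ = 1 := Complex.norm_eq_one_of_pow_eq_one h3 (by norm_num)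
  have h0 : χ y ≠ 0 := by intro h; simp [h] at hn
  have h4 : χ y * (starRingEnd ℂ) (χ y) = 1 := by
    rw [Complex.mul_conj, Complex.normSq_eq_norm_sq, hn]; simp
  apply mul_left_cancel₀ h0
  rw [h4, ← h3]; ring

lemma chi_neg_one (hχ : orderOf χ = 3) : χ (-1) = 1 := by
  have h3 := chi_cube χ hχ (y := -1) (by simp)
  have h2 : χ (-1) ^ 2 = 1 := by rw [← map_pow]; simp
  calc χ (-1) = χ (-1) ^ 3 := by rw [pow_succ, h2, one_mul]
    _ = 1 := h3

lemma chi_E (hχ : orderOf χ = 3) : ∃ E : ℕ, f = 3 * E + 1 ∧ ∀ y : ZMod f, y ≠ 0 → χ y = 1 → y ^ E = 1 := by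
  obtain ⟨g, hg⟩ := IsCyclic.exists_generator (α := (ZMod f)ˣ)
  have hpow : ∀ u : (ZMod f)ˣ, ∃ k : ℕ, g ^ k = u := by
    intro u
    have := hg u
    rw [← mem_powers_iff_mem_zpowers] at this
    exact this
  have h3 := chi_cube χ hχ (y := (g : ZMod f)) g.ne_zero
  have hg1 : χ (g : ZMod f) ≠ 1 := by
    intro h1
    have : χ = 1 := by
      apply MulChar.ext
      intro u
      obtain ⟨k, rfl⟩ := hpow u
      simp [h1]
    rw [this] at hχ
    simp at hχ
  have hord : orderOf (χ (g : ZMod f)) = 3 := by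
    have : Fact (Nat.Prime 3) := ⟨Nat.prime_three⟩
    exact orderOf_eq_prime h3 hg1
  have hgf : g ^ (f - 1) = 1 := ZMod.units_pow_card_sub_one_eq_one f g
  have hd : 3 ∣ f - 1 := by
    rw [← hord]
    apply orderOf_dvd_of_pow_eq_one
    rw [← map_pow, ← Units.val_pow_eq_pow_val, hgf]; simp
  obtain ⟨E, hE⟩ := hd
  have hfp := (Fact.out : f.Prime).one_lt
  refine ⟨E, by omega, ?_⟩
  intro y hy hy1
  obtain ⟨k, hk⟩ := hpow (Units.mk0 y hy)
  have hyk : y = (g : ZMod f) ^ k := by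
    rw [← Units.val_pow_eq_pow_val, hk]; rfl
  have hk3 : 3 ∣ k := by
    rw [← hord]
    apply orderOf_dvd_of_pow_eq_one
    rw [← map_pow, ← hyk, hy1]
  obtain ⟨j, rfl⟩ := hk3
  rw [hyk, ← Units.val_pow_eq_pow_val, ← Units.val_pow_eq_pow_val]
  have : (g ^ (3 * j)) ^ E = 1 := by
    rw [← pow_mul, show 3 * j * E = (3 * E) * j by ring, ← hE, pow_mul, hgf, one_pow]
  rw [this]; simp

/-- multiset of roots of the auxiliary polynomial -/
def rootsM {α : Type*} (b c : α × α × α) : Multiset α :=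
  {b.1, b.2.1, b.2.2, c.1, c.1, c.2.1, c.2.1, c.2.2, c.2.2}

/-- product of three character values -/
noncomputable def wt {f : ℕ} (χ : DirichletCharacter ℂ f) (b : ZMod f × ZMod f × ZMod f) (x : ZMod f) : ℂ :=
  χ (x - b.1) * χ (x - b.2.1) * χ (x - b.2.2)

lemma wt_norm (b : ZMod f × ZMod f × ZMod f) (x : ZMod f) : ‖wt χ b x‖ ≤ 1 := by
  have h : ∀ y, ‖χ y‖ ≤ 1 := fun y => DirichletCharacter.norm_le_one χ y
  unfold wt
  rw [norm_mul, norm_mul]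
  have h1 := h (x - b.1)
  have h2 := h (x - b.2.1)
  have h3 := h (x - b.2.2)
  exact mul_le_one₀ (mul_le_one₀ h1 (norm_nonneg _) h2) (norm_nonneg _) h3

lemma charsum_good (hχ : orderOf χ = 3) (hf : 10 ^ 20 ≤ f) (b c : ZMod f × ZMod f × ZMod f) (r : ZMod f)
    (hr : ¬ 3 ∣ (rootsM b c).count r) :
    (∑ x, wt χ b x * (starRingEnd ℂ) (wt χ c x)).re ≤ 31 * √f := by
  classical
  obtain ⟨E, hE, hEχ⟩ := chi_E χ hχ
  set M := rootsM b c with hM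
  have hMcard : Multiset.card M = 9 := by simp [hM, rootsM]
  set G : (ZMod f)[X] := (M.map fun a => X - C a).prod with hG
  have hroots : G.roots = M := roots_multiset_prod_X_sub_C M
  have hGne : G ≠ 0 := (monic_multiset_prod_of_monic _ _ fun a _ => monic_X_sub_C a).ne_zero
  have hdeg : G.natDegree = 9 := by rw [hG, natDegree_multiset_prod_X_sub_C_eq_card, hMcard]
  have heval : ∀ x, wt χ b x * (starRingEnd ℂ) (wt χ c x) = χ (G.eval x) := by
    intro x
    simp only [wt, map_mul, chi_conj χ hχ, hG, hM, rootsM]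
    simp
    ring
  have hmult : rootMultiplicity r G = M.count r := by rw [← count_roots, hroots]
  obtain ⟨G1, hGG, hG1⟩ := exists_eq_pow_rootMultiplicity_mul_and_not_dvd G hGne r
  have hstep := stepanov f E (rootMultiplicity r G) hE hf
    (by rw [hmult, ← hMcard]; exact Multiset.count_le_card _ _) (by rw [hmult]; exact hr) G G1 r
    hdeg.le hGG (by rw [dvd_iff_isRoot] at hG1; exact hG1)
  have hN0 : (Finset.univ.filter fun x : ZMod f => G.eval x = 0).card ≤ 9 := by
    rw [← hMcard]
    refine le_trans (Finset.card_le_card ?_) (Multiset.toFinset_card_le M)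
    intro x hx
    rw [Multiset.mem_toFinset, ← hroots, mem_roots hGne]
    simpa using hx
  have hpt : ∀ x : ZMod f, (χ (G.eval x)).re ≤ 3 / 2 * (if (G.eval x) ^ E = 1 then 1 else 0) - 1 / 2
      + 1 / 2 * (if G.eval x = 0 then 1 else 0) := by
    intro x
    by_cases h0 : G.eval x = 0
    · rw [h0, MulChar.map_nonunit _ (by simp)]
      simp
      split_ifs <;> norm_num
    · rw [if_neg h0]
      by_cases h1 : χ (G.eval x) = 1
      · rw [if_pos (hEχ _ h0 h1), h1]; norm_num
      · rw [cube_re (chi_cube χ hχ h0) h1]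
        split_ifs <;> norm_num
  rw [Finset.sum_congr rfl fun x _ => heval x, Complex.re_sum]
  refine (Finset.sum_le_sum fun x _ => hpt x).trans ?_
  rw [Finset.sum_add_distrib, Finset.sum_sub_distrib, ← Finset.mul_sum, ← Finset.mul_sum,
    Finset.sum_boole, Finset.sum_boole]
  simp only [Finset.sum_const, Finset.card_univ, ZMod.card, nsmul_eq_mul]
  have hN0' : ((Finset.univ.filter fun x : ZMod f => G.eval x = 0).card : ℝ) ≤ 9 := by
    exact_mod_cast hN0
  have hbig : (10 : ℝ) ^ 10 ≤ √f := by
    apply Real.le_sqrt_of_sq_le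
    have : ((10 ^ 20 : ℕ) : ℝ) ≤ f := by exact_mod_cast hf
    push_cast at this; linarith
  linarith

end chi

lemma bad_cases {α : Type*} [DecidableEq α] (b c : α × α × α) (h : ∀ r, 3 ∣ (rootsM b c).count r) :
    (c = (b.1, b.2.1, b.2.2) ∨ c = (b.1, b.2.2, b.2.1) ∨ c = (b.2.1, b.1, b.2.2) ∨
     c = (b.2.1, b.2.2, b.1) ∨ c = (b.2.2, b.1, b.2.1) ∨ c = (b.2.2, b.2.1, b.1)) ∨
    (b = (b.1, b.1, b.1) ∧ c = (c.1, c.1, c.1)) := by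
  obtain ⟨b0, b1, b2⟩ := b
  obtain ⟨c0, c1, c2⟩ := c
  simp only [rootsM, Multiset.insert_eq_cons, Multiset.count_cons, Multiset.count_singleton] at h
  have h1 := h b0
  have h2 := h b1
  have h3 := h b2
  have h4 := h c0
  have h5 := h c1
  have h6 := h c2
  clear h
  simp only [Prod.mk.injEq]
  grind (splits := 30)


lemma bad_card {α : Type*} [DecidableEq α] (I : Finset α)
    [DecidablePred fun p : (α × α × α) × (α × α × α) => ∀ r, 3 ∣ (rootsM p.1 p.2).count r] :
    (((I ×ˢ I ×ˢ I) ×ˢ (I ×ˢ I ×ˢ I)).filter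
      fun p => ∀ r, 3 ∣ (rootsM p.1 p.2).count r).card ≤ 6 * I.card ^ 3 + I.card ^ 2 := by
  classical
  let T := I ×ˢ I ×ˢ I
  have hT : T.card = I.card ^ 3 := by simp [T, Finset.card_product]; ring
  let i1 := T.image fun b => (b, (b.1, b.2.1, b.2.2))
  let i2 := T.image fun b => (b, (b.1, b.2.2, b.2.1))
  let i3 := T.image fun b => (b, (b.2.1, b.1, b.2.2))
  let i4 := T.image fun b => (b, (b.2.1, b.2.2, b.1))
  let i5 := T.image fun b => (b, (b.2.2, b.1, b.2.1))
  let i6 := T.image fun b => (b, (b.2.2, b.2.1, b.1))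
  let i7 := (I ×ˢ I).image fun u => ((u.1, u.1, u.1), (u.2, u.2, u.2))
  have hsub : (((I ×ˢ I ×ˢ I) ×ˢ (I ×ˢ I ×ˢ I)).filter
      fun p => ∀ r, 3 ∣ (rootsM p.1 p.2).count r) ⊆ i1 ∪ (i2 ∪ (i3 ∪ (i4 ∪ (i5 ∪ (i6 ∪ i7))))) := by
    rintro ⟨b, c⟩ hp
    rw [Finset.mem_filter, Finset.mem_product] at hp
    obtain ⟨⟨hb, hc⟩, hbad⟩ := hp
    simp only [Finset.mem_union]
    rcases bad_cases b c hbad with (h | h | h | h | h | h) | ⟨h1, h2⟩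
    · exact Or.inl (Finset.mem_image.2 ⟨b, hb, by rw [h]⟩)
    · exact Or.inr (Or.inl (Finset.mem_image.2 ⟨b, hb, by rw [h]⟩))
    · exact Or.inr (Or.inr (Or.inl (Finset.mem_image.2 ⟨b, hb, by rw [h]⟩)))
    · exact Or.inr (Or.inr (Or.inr (Or.inl (Finset.mem_image.2 ⟨b, hb, by rw [h]⟩))))
    · exact Or.inr (Or.inr (Or.inr (Or.inr (Or.inl (Finset.mem_image.2 ⟨b, hb, by rw [h]⟩)))))
    · exact Or.inr (Or.inr (Or.inr (Or.inr (Or.inr (Or.inl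
        (Finset.mem_image.2 ⟨b, hb, by rw [h]⟩))))))
    · refine Or.inr (Or.inr (Or.inr (Or.inr (Or.inr (Or.inr
        (Finset.mem_image.2 ⟨(b.1, c.1), ?_, ?_⟩))))))
      · exact Finset.mem_product.2 ⟨(Finset.mem_product.1 hb).1, (Finset.mem_product.1 hc).1⟩
      · exact Prod.ext h1.symm h2.symm
  refine (Finset.card_le_card hsub).trans ?_
  have c1 : i1.card ≤ I.card ^ 3 := Finset.card_image_le.trans hT.le
  have c2 : i2.card ≤ I.card ^ 3 := Finset.card_image_le.trans hT.le
  have c3 : i3.card ≤ I.card ^ 3 := Finset.card_image_le.trans hT.le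
  have c4 : i4.card ≤ I.card ^ 3 := Finset.card_image_le.trans hT.le
  have c5 : i5.card ≤ I.card ^ 3 := Finset.card_image_le.trans hT.le
  have c6 : i6.card ≤ I.card ^ 3 := Finset.card_image_le.trans hT.le
  have c7 : i7.card ≤ I.card ^ 2 := Finset.card_image_le.trans (by simp [Finset.card_product, sq])
  have u1 := Finset.card_union_le i1 (i2 ∪ (i3 ∪ (i4 ∪ (i5 ∪ (i6 ∪ i7)))))
  have u2 := Finset.card_union_le i2 (i3 ∪ (i4 ∪ (i5 ∪ (i6 ∪ i7))))
  have u3 := Finset.card_union_le i3 (i4 ∪ (i5 ∪ (i6 ∪ i7)))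
  have u4 := Finset.card_union_le i4 (i5 ∪ (i6 ∪ i7))
  have u5 := Finset.card_union_le i5 (i6 ∪ i7)
  have u6 := Finset.card_union_le i6 i7
  omega

lemma sixth_moment {f : ℕ} [Fact f.Prime] (χ : DirichletCharacter ℂ f) (hχ : orderOf χ = 3)
    (hf : 10 ^ 20 ≤ f) (I : Finset (ZMod f)) :
    ∑ x, ‖∑ b ∈ I, χ (x - b)‖ ^ 6 ≤
      (6 * (I.card : ℝ) ^ 3 + (I.card : ℝ) ^ 2) * f + 31 * √f * (I.card : ℝ) ^ 6 := by
  classical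
  set T := I ×ˢ I ×ˢ I with hT
  have hTc : T.card = I.card ^ 3 := by simp [T, Finset.card_product]; ring
  have hcube : ∀ x, (∑ b ∈ I, χ (x - b)) ^ 3 = ∑ p ∈ T, wt χ p x := by
    intro x
    simp only [hT, wt, Finset.sum_product, ← Finset.mul_sum, ← Finset.sum_mul]
    ring
  have hpt : ∀ x, ‖∑ b ∈ I, χ (x - b)‖ ^ 6
      = ∑ p ∈ T ×ˢ T, (wt χ p.1 x * (starRingEnd ℂ) (wt χ p.2 x)).re := by
    intro x
    rw [← Complex.re_sum, Finset.sum_product]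
    dsimp only
    rw [← Finset.sum_mul_sum, ← map_sum (starRingEnd ℂ), ← hcube,
      Complex.mul_conj, Complex.ofReal_re, Complex.normSq_eq_norm_sq, norm_pow]
    ring
  simp only [hpt]
  rw [Finset.sum_comm]
  have hle : ∀ p ∈ T ×ˢ T, ∑ x, (wt χ p.1 x * (starRingEnd ℂ) (wt χ p.2 x)).re
      ≤ (if ∀ r, 3 ∣ (rootsM p.1 p.2).count r then 1 else 0) * (f : ℝ) + 31 * √f := by
    intro p _
    by_cases hp : ∀ r, 3 ∣ (rootsM p.1 p.2).count r
    · rw [if_pos hp]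
      have h1 : ∑ x : ZMod f, (wt χ p.1 x * (starRingEnd ℂ) (wt χ p.2 x)).re ≤ ∑ x : ZMod f, (1 : ℝ) := by
        apply Finset.sum_le_sum
        intro x _
        refine (Complex.re_le_norm _).trans ?_
        rw [norm_mul, RCLike.norm_conj]
        exact mul_le_one₀ (wt_norm χ _ _) (norm_nonneg _) (wt_norm χ _ _)
      simp only [Finset.sum_const, Finset.card_univ, ZMod.card, nsmul_eq_mul, mul_one] at h1
      have := Real.sqrt_nonneg (f : ℝ)
      linarith
    · rw [if_neg hp]
      push Not at hp
      obtain ⟨r, hr⟩ := hp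
      have := charsum_good χ hχ hf p.1 p.2 r hr
      rw [Complex.re_sum] at this
      linarith
  refine (Finset.sum_le_sum hle).trans ?_
  rw [Finset.sum_add_distrib, ← Finset.sum_mul, Finset.sum_boole, Finset.sum_const,
    Finset.card_product, hTc, nsmul_eq_mul]
  have hb : ((((T ×ˢ T).filter fun p => ∀ r, 3 ∣ (rootsM p.1 p.2).count r).card : ℕ) : ℝ)
      ≤ 6 * (I.card : ℝ) ^ 3 + (I.card : ℝ) ^ 2 := by
    have := bad_card I
    rw [← hT] at this
    exact_mod_cast this
  push_cast
  have : (0 : ℝ) ≤ f := by positivity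
  nlinarith [mul_le_mul_of_nonneg_right hb this]

end stepanov_part

lemma odd_sq_sum (n : ℕ) :
    ∑ j ∈ Finset.range n, (1 : ℝ) / (2 * (j : ℝ) + 3) ^ 2 ≤ 1 / 4 - 1 / (4 * ((n : ℝ) + 1)) := by
  induction n with
  | zero => norm_num
  | succ n ih =>
    rw [Finset.sum_range_succ]
    have : (1 : ℝ) / (2 * n + 3) ^ 2 ≤ 1 / (4 * (n + 1)) - 1 / (4 * ((n + 1 : ℕ) + 1 : ℝ)) := by
      have hn : (0 : ℝ) ≤ n := by positivity
      push_cast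
      rw [div_sub_div _ _ (by positivity) (by positivity), div_le_div_iff₀ (by positivity) (by positivity)]
      nlinarith
    linarith

lemma mult_count (A d : ℕ) : ((Finset.Icc 1 A).filter (d ∣ ·)).card = A / d :=
  Nat.Ioc_filter_dvd_card_eq_div A d

lemma coprime_count (A R : ℕ) : (A * R : ℝ) / 2 ≤
    (((Finset.Icc 1 A) ×ˢ (Finset.Icc 1 R)).filter fun p => Nat.Coprime p.1 p.2).card := by
  classical
  set U := (Finset.Icc 1 A) ×ˢ (Finset.Icc 1 R) with hU
  have hUc : U.card = A * R := by simp [hU]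
  let m : ℕ → Finset (ℕ × ℕ) := fun d => ((Finset.Icc 1 A).filter (d ∣ ·)) ×ˢ ((Finset.Icc 1 R).filter (d ∣ ·))
  have hm : ∀ d, 0 < d → ((m d).card : ℝ) ≤ A * R * (1 / (d : ℝ) ^ 2) := by
    intro d hd
    simp only [m, Finset.card_product, mult_count]
    push_cast
    have h1 : ((A / d : ℕ) : ℝ) ≤ A / d := Nat.cast_div_le
    have h2 : ((R / d : ℕ) : ℝ) ≤ R / d := Nat.cast_div_le
    calc ((A / d : ℕ) : ℝ) * ((R / d : ℕ) : ℝ) ≤ (A / d) * (R / d) := by gcongr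
      _ = A * R * (1 / (d : ℝ) ^ 2) := by
        have : (d : ℝ) ≠ 0 := by positivity
        field_simp
  have hsub : (U.filter fun p => ¬ Nat.Coprime p.1 p.2) ⊆
      m 2 ∪ (Finset.range A).biUnion fun j => m (2 * j + 3) := by
    rintro ⟨a, n⟩ hp
    rw [Finset.mem_filter, hU, Finset.mem_product, Finset.mem_Icc, Finset.mem_Icc] at hp
    obtain ⟨⟨ha, hn⟩, hnc⟩ := hp
    obtain ⟨p, hp, hpa, hpn⟩ := Nat.Prime.not_coprime_iff_dvd.1 hnc
    have hmem : (a, n) ∈ m p := by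
      simp only [m, Finset.mem_product, Finset.mem_filter, Finset.mem_Icc]
      exact ⟨⟨ha, hpa⟩, ⟨hn, hpn⟩⟩
    rw [Finset.mem_union, Finset.mem_biUnion]
    rcases hp.eq_two_or_odd with h2 | h2
    · left; rw [← h2]; exact hmem
    · right
      have hp2 := hp.two_le
      have hple := Nat.le_of_dvd (by have := ha.1; simp at this; omega) hpa
      simp only at ha hple
      refine ⟨(p - 3) / 2, Finset.mem_range.2 (by omega), ?_⟩
      rw [show 2 * ((p - 3) / 2) + 3 = p by omega]; exact hmem
  have h1 : ((U.filter fun p => ¬ Nat.Coprime p.1 p.2).card : ℝ) ≤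
      (m 2).card + ∑ j ∈ Finset.range A, ((m (2 * j + 3)).card : ℝ) := by
    have := (Finset.card_le_card hsub).trans ((Finset.card_union_le _ _).trans
      (Nat.add_le_add_left Finset.card_biUnion_le _))
    exact_mod_cast this
  have h2 : ∑ j ∈ Finset.range A, ((m (2 * j + 3)).card : ℝ) ≤ A * R * (1 / 4) := by
    calc ∑ j ∈ Finset.range A, ((m (2 * j + 3)).card : ℝ)
        ≤ ∑ j ∈ Finset.range A, A * R * ((1 : ℝ) / (2 * j + 3) ^ 2) := by
          apply Finset.sum_le_sum
          intro j _
          have := hm (2 * j + 3) (by omega)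
          push_cast at this
          exact this
      _ = A * R * ∑ j ∈ Finset.range A, (1 : ℝ) / (2 * j + 3) ^ 2 := by rw [Finset.mul_sum]
      _ ≤ A * R * (1 / 4) := by
          have := odd_sq_sum A
          have h0 : (0 : ℝ) ≤ 1 / (4 * (A + 1)) := by positivity
          gcongr
          linarith
  have h3 := hm 2 (by norm_num)
  have h4 : ((U.filter fun p => Nat.Coprime p.1 p.2).card : ℝ)
      + (U.filter fun p => ¬ Nat.Coprime p.1 p.2).card = A * R := by
    have := Finset.card_filter_add_card_filter_not (s := U) (fun p => Nat.Coprime p.1 p.2)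
    rw [hUc] at this
    exact_mod_cast this
  norm_num at h3
  linarith

lemma ap_count (q : ℕ) (hq : q.Prime) (H a : ℕ) (N : ℤ) (hc : IsCoprime N (a : ℤ)) :
    (((Finset.Icc (-(H : ℤ)) H).filter fun b => (q : ℤ) ∣ N - a * b).card : ℝ) ≤ (2 * H + 1) / q + 1 := by
  have hqI : Prime (q : ℤ) := Nat.prime_iff_prime_int.1 hq
  have hq0 : (0 : ℤ) < q := by exact_mod_cast hq.pos
  by_cases hqa : (q : ℤ) ∣ a
  · rw [Finset.filter_false_of_mem]
    · simp; positivity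
    · intro b _ hb
      have : (q : ℤ) ∣ N := by
        have := dvd_add hb (dvd_mul_of_dvd_left hqa b)
        simpa using this
      exact hqI.not_isUnit (hc.isUnit_of_dvd' this hqa)
  by_cases hex : ∃ b₀, (q : ℤ) ∣ N - a * b₀
  · obtain ⟨b₀, hb₀⟩ := hex
    have hsub : ((Finset.Icc (-(H : ℤ)) H).filter fun b => (q : ℤ) ∣ N - a * b) ⊆
        (Finset.Ioc (-(H : ℤ) - 1) H).filter (· ≡ b₀ [ZMOD q]) := by
      intro b hb
      rw [Finset.mem_filter, Finset.mem_Icc] at hb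
      rw [Finset.mem_filter, Finset.mem_Ioc]
      refine ⟨by omega, ?_⟩
      have h1 : (q : ℤ) ∣ a * (b₀ - b) := by
        have := dvd_sub hb.2 hb₀
        ring_nf at this ⊢
        exact this
      exact (Int.modEq_iff_dvd).2 ((hqI.dvd_or_dvd h1).resolve_left hqa)
    have h2 := Finset.card_le_card hsub
    have h3 := Int.Ioc_filter_modEq_card (-(H : ℤ) - 1) H hq0 b₀
    set K := ((Finset.Ioc (-(H : ℤ) - 1) H).filter (· ≡ b₀ [ZMOD q])).card
    have hqQ : (0 : ℚ) < q := by exact_mod_cast hq.pos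
    have h4 : (K : ℚ) ≤ (2 * H + 1) / q + 1 := by
      have h5 : (K : ℚ) = ((K : ℤ) : ℚ) := by simp
      rw [h5, h3, Int.cast_max]
      apply max_le
      · have e1 := Int.floor_le (((H : ℤ) - b₀ : ℚ) / ((q : ℤ) : ℚ))
        have e2 := Int.lt_floor_add_one ((((-(H : ℤ) - 1 : ℤ) : ℚ) - b₀) / ((q : ℤ) : ℚ))
        have e3 : (((H : ℤ) - b₀ : ℚ) / ((q : ℤ) : ℚ))
          - ((((-(H : ℤ) - 1 : ℤ) : ℚ) - b₀) / ((q : ℤ) : ℚ)) = (2 * H + 1) / q := by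
          push_cast
          rw [← sub_div]; congr 1; ring
        rw [Int.cast_sub]
        linarith
      · simp; positivity
    have h6 : (K : ℝ) ≤ (2 * H + 1) / q + 1 := by
      have := (Rat.cast_le (K := ℝ)).2 h4
      push_cast at this
      exact this
    have h7 : (((Finset.Icc (-(H : ℤ)) H).filter fun b => (q : ℤ) ∣ N - a * b).card : ℝ) ≤ K := by
      exact_mod_cast h2
    linarith
  · push Not at hex
    rw [Finset.filter_false_of_mem (fun b _ => hex b)]
    simp; positivity

lemma lower_bound {f : ℕ} [Fact f.Prime] (χ : DirichletCharacter ℂ f) (hχ : orderOf χ = 3)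
    (ω : ℂ) (hω : ω ^ 3 = 1) (q₁ q₂ : ℕ) (hq₁ : q₁.Prime) (hq₂ : q₂.Prime)
    (h1 : 379 ≤ q₁) (h2 : 379 ≤ q₂) (H : ℕ) (Y : ℤ)
    (hno : ∀ m : ℤ, |m| ≤ Y → ¬ (q₁ : ℤ) ∣ m → ¬ (q₂ : ℤ) ∣ m →
      (m : ZMod f) ≠ 0 ∧ χ (m : ZMod f) ≠ ω)
    (a : ℕ) (ha : (a : ZMod f) ≠ 0) (N : ℤ) (hc : IsCoprime N (a : ℤ))
    (hY : |N| + a * H ≤ Y) :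
    (2 * H + 1 : ℝ) / 2 - 3 * ((2 * H + 1) / 379 + 1) ≤
      ‖∑ b ∈ Finset.Icc (-(H : ℤ)) H, χ ((N : ZMod f) * (a : ZMod f)⁻¹ - (b : ZMod f))‖ := by
  classical
  set I := Finset.Icc (-(H : ℤ)) H with hI
  have hIc : (I.card : ℝ) = 2 * H + 1 := by
    have : I.card = 2 * H + 1 := by rw [hI, Int.card_Icc]; omega
    rw [this]; push_cast; ring
  have hωn : ‖ω‖ = 1 := Complex.norm_eq_one_of_pow_eq_one hω (by norm_num)
  have hωc : (starRingEnd ℂ) ω * ω = 1 := by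
    rw [mul_comm, Complex.mul_conj, Complex.normSq_eq_norm_sq, hωn]; simp
  have han : ‖χ (a : ZMod f)‖ = 1 :=
    Complex.norm_eq_one_of_pow_eq_one (chi_cube χ hχ ha) (by norm_num)
  have hmul : ∀ b : ℤ, χ (a : ZMod f) * χ ((N : ZMod f) * (a : ZMod f)⁻¹ - (b : ZMod f))
      = χ ((N - a * b : ℤ) : ZMod f) := by
    intro b
    rw [← map_mul]
    congr 1
    push_cast
    field_simp
  have hnorm : ‖∑ b ∈ I, χ ((N : ZMod f) * (a : ZMod f)⁻¹ - (b : ZMod f))‖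
      = ‖(starRingEnd ℂ) ω * ∑ b ∈ I, χ ((N - a * b : ℤ) : ZMod f)‖ := by
    rw [norm_mul, RCLike.norm_conj, hωn, one_mul, ← Finset.sum_congr rfl (fun b _ => hmul b),
      ← Finset.mul_sum, norm_mul, han, one_mul]
  rw [hnorm]
  have hpt : ∀ b ∈ I, ((starRingEnd ℂ) ω * χ ((N - a * b : ℤ) : ZMod f)).re ≤
      -1 / 2 + 3 / 2 * (if (q₁ : ℤ) ∣ N - a * b then 1 else 0)
        + 3 / 2 * (if (q₂ : ℤ) ∣ N - a * b then 1 else 0) := by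
    intro b hb
    have htriv : ((starRingEnd ℂ) ω * χ ((N - a * b : ℤ) : ZMod f)).re ≤ 1 := by
      refine (Complex.re_le_norm _).trans ?_
      rw [norm_mul, RCLike.norm_conj, hωn, one_mul]
      exact DirichletCharacter.norm_le_one χ _
    by_cases hd1 : (q₁ : ℤ) ∣ N - a * b
    · rw [if_pos hd1]
      split_ifs <;> linarith
    by_cases hd2 : (q₂ : ℤ) ∣ N - a * b
    · rw [if_pos hd2]
      split_ifs; linarith
    rw [if_neg hd1, if_neg hd2]
    rw [hI, Finset.mem_Icc] at hb
    have hab : |N - a * b| ≤ Y := by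
      refine le_trans (abs_sub _ _) (le_trans ?_ hY)
      have : |b| ≤ H := abs_le.2 hb
      rw [abs_mul, Nat.abs_cast]
      gcongr
    obtain ⟨hm0, hmω⟩ := hno _ hab hd1 hd2
    rw [cube_re]
    · norm_num
    · rw [mul_pow, chi_cube χ hχ hm0, ← map_pow, hω]; simp
    · intro h
      apply hmω
      have : ω * ((starRingEnd ℂ) ω * χ ((N - a * b : ℤ) : ZMod f)) = ω := by rw [h, mul_one]
      rw [← mul_assoc, mul_comm ω, hωc, one_mul] at this
      exact this
  have hsum := Finset.sum_le_sum hpt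
  rw [Finset.sum_add_distrib, Finset.sum_add_distrib, ← Finset.mul_sum, ← Finset.mul_sum,
    Finset.sum_boole, Finset.sum_boole, Finset.sum_const, nsmul_eq_mul, hIc, ← Complex.re_sum,
    ← Finset.mul_sum] at hsum
  have c1 := ap_count q₁ hq₁ H a N hc
  have c2 := ap_count q₂ hq₂ H a N hc
  rw [← hI] at c1 c2
  have d1 : (2 * H + 1 : ℝ) / q₁ ≤ (2 * H + 1) / 379 := by
    have : (379 : ℝ) ≤ q₁ := by exact_mod_cast h1
    gcongr
  have d2 : (2 * H + 1 : ℝ) / q₂ ≤ (2 * H + 1) / 379 := by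
    have : (379 : ℝ) ≤ q₂ := by exact_mod_cast h2
    gcongr
  have hre := Complex.abs_re_le_norm ((starRingEnd ℂ) ω * ∑ b ∈ I, χ ((N - a * b : ℤ) : ZMod f))
  have hre2 := (abs_le.1 hre).1
  linarith

lemma frac_inj {f : ℕ} [Fact f.Prime] (A R : ℕ) (hf : 2 * A * R < f) (s s' : ℤ)
    (hs : s = 1 ∨ s = -1) (hs' : s' = 1 ∨ s' = -1) (a n a' n' : ℕ) (ha : 1 ≤ a ∧ a ≤ A)
    (ha' : 1 ≤ a' ∧ a' ≤ A) (hn : 1 ≤ n ∧ n ≤ R) (hn' : 1 ≤ n' ∧ n' ≤ R)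
    (hc : Nat.Coprime a n) (hc' : Nat.Coprime a' n') (ha0 : (a : ZMod f) ≠ 0) (ha0' : (a' : ZMod f) ≠ 0)
    (h : ((s * n : ℤ) : ZMod f) * (a : ZMod f)⁻¹ = ((s' * n' : ℤ) : ZMod f) * (a' : ZMod f)⁻¹) :
    s = s' ∧ a = a' ∧ n = n' := by
  have h0 : ((s * n * a' - s' * n' * a : ℤ) : ZMod f) = 0 := by
    push_cast at h ⊢
    field_simp at h
    linear_combination h
  rw [ZMod.intCast_zmod_eq_zero_iff_dvd] at h0
  have b1 : (n : ℤ) * a' ≤ R * A := by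
    have : n * a' ≤ R * A := Nat.mul_le_mul hn.2 ha'.2
    exact_mod_cast this
  have b2 : (n' : ℤ) * a ≤ R * A := by
    have : n' * a ≤ R * A := Nat.mul_le_mul hn'.2 ha.2
    exact_mod_cast this
  have p1 : (1 : ℤ) ≤ n * a' := by
    have : 1 * 1 ≤ n * a' := Nat.mul_le_mul hn.1 ha'.1
    exact_mod_cast this
  have p2 : (1 : ℤ) ≤ n' * a := by
    have : 1 * 1 ≤ n' * a := Nat.mul_le_mul hn'.1 ha.1
    exact_mod_cast this
  have hfI : 2 * ((R : ℤ) * A) < f := by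
    have : 2 * (R * A) < f := by linarith [mul_comm R A, mul_assoc 2 A R]
    exact_mod_cast this
  have hz : s * n * a' - s' * n' * a = 0 := by
    apply Int.eq_zero_of_abs_lt_dvd h0
    rw [abs_lt]
    rcases hs with rfl | rfl <;> rcases hs' with rfl | rfl <;> constructor <;> linarith
  have hss : s = s' ∧ (n : ℤ) * a' = n' * a := by
    rcases hs with rfl | rfl <;> rcases hs' with rfl | rfl
    · exact ⟨rfl, by linarith⟩
    · exfalso; linarith
    · exfalso; linarith
    · exact ⟨rfl, by linarith⟩
  have hna : n * a' = n' * a := by exact_mod_cast hss.2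
  have k1 : a ∣ a' := hc.dvd_of_dvd_mul_left (Dvd.intro_left n' hna.symm)
  have k2 : a' ∣ a := hc'.dvd_of_dvd_mul_left (Dvd.intro_left n hna)
  have haa := Nat.dvd_antisymm k1 k2
  refine ⟨hss.1, haa, ?_⟩
  subst haa
  exact Nat.eq_of_mul_eq_mul_right ha.1 hna

lemma combine {f : ℕ} [Fact f.Prime] (χ : DirichletCharacter ℂ f) (hχ : orderOf χ = 3)
    (hf : 10 ^ 20 ≤ f)
    (ω : ℂ) (hω : ω ^ 3 = 1) (q₁ q₂ : ℕ) (hq₁ : q₁.Prime) (hq₂ : q₂.Prime)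
    (h1 : 379 ≤ q₁) (h2 : 379 ≤ q₂) (H A R : ℕ) (Y : ℤ)
    (hno : ∀ m : ℤ, |m| ≤ Y → ¬ (q₁ : ℤ) ∣ m → ¬ (q₂ : ℤ) ∣ m →
      (m : ZMod f) ≠ 0 ∧ χ (m : ZMod f) ≠ ω)
    (hHf : 2 * H + 1 < f) (hAf : A < f) (hARf : 2 * A * R < f) (hY : (R : ℤ) + A * H ≤ Y)
    (hlb : (0 : ℝ) ≤ (2 * H + 1 : ℝ) / 2 - 3 * ((2 * H + 1) / 379 + 1)) :
    (A * R : ℝ) * ((2 * H + 1 : ℝ) / 2 - 3 * ((2 * H + 1) / 379 + 1)) ^ 6 ≤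
      (6 * (2 * H + 1 : ℝ) ^ 3 + (2 * H + 1 : ℝ) ^ 2) * f + 31 * √f * (2 * H + 1 : ℝ) ^ 6 := by
  classical
  set lb := (2 * H + 1 : ℝ) / 2 - 3 * ((2 * H + 1) / 379 + 1) with hlbdef
  set I := Finset.Icc (-(H : ℤ)) H with hI
  have hIc : I.card = 2 * H + 1 := by rw [hI, Int.card_Icc]; omega
  have hinj : Set.InjOn (fun b : ℤ => (b : ZMod f)) (I : Set ℤ) := by
    intro b hb b' hb' hbb
    simp only [hI, Finset.coe_Icc, Set.mem_Icc] at hb hb'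
    have h0 : ((b - b' : ℤ) : ZMod f) = 0 := by
      push_cast; exact sub_eq_zero.2 hbb
    rw [ZMod.intCast_zmod_eq_zero_iff_dvd] at h0
    have := Int.eq_zero_of_abs_lt_dvd h0 (by rw [abs_lt]; constructor <;> omega)
    omega
  have hmom := sixth_moment χ hχ hf (I.image fun b : ℤ => (b : ZMod f))
  rw [Finset.card_image_of_injOn hinj, hIc] at hmom
  push_cast at hmom
  refine le_trans ?_ hmom
  let P := ((Finset.Icc 1 A) ×ˢ (Finset.Icc 1 R)).filter fun p => Nat.Coprime p.1 p.2
  let K : Finset (ℤ × ℕ × ℕ) := ({1, -1} : Finset ℤ) ×ˢ P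
  have hK : (A * R : ℝ) ≤ K.card := by
    have := coprime_count A R
    have h2 : K.card = 2 * P.card := by simp [K, Finset.card_product]
    rw [h2]; push_cast
    simp only [P]; linarith
  have ha0 : ∀ a : ℕ, 1 ≤ a → a ≤ A → (a : ZMod f) ≠ 0 := by
    intro a h1 h2 h
    rw [ZMod.natCast_eq_zero_iff] at h
    have := Nat.le_of_dvd h1 h
    omega
  let φ : ℤ × ℕ × ℕ → ZMod f := fun k => ((k.1 * k.2.2 : ℤ) : ZMod f) * (k.2.1 : ZMod f)⁻¹
  have hKmem : ∀ k ∈ K, (k.1 = 1 ∨ k.1 = -1) ∧ (1 ≤ k.2.1 ∧ k.2.1 ≤ A) ∧ (1 ≤ k.2.2 ∧ k.2.2 ≤ R) ∧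
      Nat.Coprime k.2.1 k.2.2 := by
    intro k hk
    simp only [K, P, Finset.mem_product, Finset.mem_filter, Finset.mem_Icc, Finset.mem_insert,
      Finset.mem_singleton] at hk
    tauto
  have hφinj : Set.InjOn φ (K : Set (ℤ × ℕ × ℕ)) := by
    rintro ⟨s, a, n⟩ hk ⟨s', a', n'⟩ hk' hkk
    obtain ⟨hs, ha, hn, hc⟩ := hKmem _ hk
    obtain ⟨hs', ha', hn', hc'⟩ := hKmem _ hk'
    obtain ⟨e1, e2, e3⟩ := frac_inj A R hARf s s' hs hs' a n a' n' ha ha' hn hn' hc hc'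
      (ha0 a ha.1 ha.2) (ha0 a' ha'.1 ha'.2) hkk
    rw [e1, e2, e3]
  calc (A * R : ℝ) * lb ^ 6 ≤ K.card * lb ^ 6 := by gcongr
    _ = ∑ k ∈ K, lb ^ 6 := by simp
    _ ≤ ∑ k ∈ K, ‖∑ b ∈ I.image (fun b : ℤ => (b : ZMod f)), χ (φ k - b)‖ ^ 6 := by
        apply Finset.sum_le_sum
        rintro ⟨s, a, n⟩ hk
        obtain ⟨hs, ha, hn, hc⟩ := hKmem _ hk
        simp only at hs ha hn hc
        have hcop : IsCoprime (s * n : ℤ) (a : ℤ) := by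
          have h3 : IsCoprime (n : ℤ) (a : ℤ) := Nat.isCoprime_iff_coprime.2 hc.symm
          rcases hs with rfl | rfl
          · simpa using h3
          · simpa using h3.neg_left
        have habs : |s * n| + a * H ≤ Y := by
          have e : |s * (n : ℤ)| = n := by
            rcases hs with rfl | rfl <;> simp
          rw [e]
          refine le_trans ?_ hY
          have h4 : (n : ℤ) ≤ R := by exact_mod_cast hn.2
          have h5 : (a : ℤ) ≤ A := by exact_mod_cast ha.2
          gcongr
        have := lower_bound χ hχ ω hω q₁ q₂ hq₁ hq₂ h1 h2 H Y hno a (ha0 a ha.1 ha.2) (s * n) hcop habs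
        rw [Finset.sum_image hinj]
        gcongr
    _ = ∑ x ∈ K.image φ, ‖∑ b ∈ I.image (fun b : ℤ => (b : ZMod f)), χ (x - b)‖ ^ 6 := by
        rw [Finset.sum_image hφinj]
    _ ≤ ∑ x, ‖∑ b ∈ I.image (fun b : ℤ => (b : ZMod f)), χ (x - b)‖ ^ 6 := by
        apply Finset.sum_le_sum_of_subset_of_nonneg (Finset.subset_univ _)
        intro x _ _
        positivity

lemma final_numeric (g : ℝ) (hg : 2400 ≤ g) (B A R : ℝ) (hB1 : g - 1 ≤ B) (hB2 : B ≤ g + 1)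
    (hA : 95 * g ≤ A) (hR : 47.6 * g ^ 2 ≤ R)
    (h : A * R * (B / 2 - 3 * (B / 379 + 1)) ^ 6 ≤ (6 * B ^ 3 + B ^ 2) * g ^ 6 + 31 * g ^ 3 * B ^ 6) :
    False := by
  have hg0 : 0 < g := by linarith
  have l1 : 0.49 * g ≤ B / 2 - 3 * (B / 379 + 1) := by
    linarith
  have l2 : B ≤ 1.001 * g := by linarith
  have hB0 : 0 ≤ B := by linarith
  have l3 : (0.49 * g) ^ 6 ≤ (B / 2 - 3 * (B / 379 + 1)) ^ 6 := by gcongr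
  have l4 : (95 * g) * (47.6 * g ^ 2) ≤ A * R := by gcongr; linarith
  have l5 : (95 * g) * (47.6 * g ^ 2) * (0.49 * g) ^ 6 ≤ A * R * (B / 2 - 3 * (B / 379 + 1)) ^ 6 := by
    apply mul_le_mul l4 l3 (by positivity)
    exact le_trans (by positivity) l4
  have l6 : (6 * B ^ 3 + B ^ 2) * g ^ 6 + 31 * g ^ 3 * B ^ 6 ≤
     (6 * (1.001 * g) ^ 3 + (1.001 * g) ^ 2) * g ^ 6 + 31 * g ^ 3 * (1.001 * g) ^ 6 := by gcongr
  have l7 : g ^ 8 * 2400 ≤ g ^ 9 := by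
    rw [pow_succ g 8]; gcongr
  have l8 : 0 < g ^ 9 := by positivity
  have l9 := l5.trans (h.trans l6)
  ring_nf at l9 l7
  linarith

set_option maxHeartbeats 2000000 in
lemma main_aux (f : ℕ) (hf : f.Prime)
    (hf1 : 2 * 10 ^ 20 ≤ f)
    (χ : DirichletCharacter ℂ f) (hχ : orderOf χ = 3)
    (q₁ q₂ : ℕ) (hq₁p : q₁.Prime) (hq₁₂ : q₁ < q₂) (hq₂p : q₂.Prime)
    (hq₁379 : 379 ≤ q₁)
    (ω : ℂ) (hω : ω ^ 3 = 1) :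
    ∃ m : ℕ, 0 < m ∧ χ (m : ZMod f) = ω ∧ Nat.Coprime m (q₁ * q₂) ∧
      (m : ℝ) ≤ 14 * (f : ℝ) ^ ((1 : ℝ) / 3) * Real.sqrt (Real.log f) := by
  have : Fact f.Prime := ⟨hf⟩
  by_contra hcon
  push Not at hcon
  have hfR : (2 * 10 ^ 20 : ℝ) ≤ f := by exact_mod_cast hf1
  have hf0 : (0 : ℝ) ≤ f := by positivity
  obtain ⟨g, hgdef⟩ : ∃ g, g = (f : ℝ) ^ ((1 : ℝ) / 6) := ⟨_, rfl⟩
  have hgpos : 0 ≤ g := by rw [hgdef]; positivity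
  have hg6 : g ^ 6 = f := by
    rw [hgdef, ← Real.rpow_natCast, ← Real.rpow_mul hf0]; norm_num
  have hg3 : √(f : ℝ) = g ^ 3 := by
    rw [← hg6, show g ^ 6 = (g ^ 3) ^ 2 by ring, Real.sqrt_sq (by positivity)]
  have hg2 : (f : ℝ) ^ ((1 : ℝ) / 3) = g ^ 2 := by
    rw [hgdef, ← Real.rpow_natCast, ← Real.rpow_mul hf0]; norm_num
  have hg : 2400 ≤ g := by
    by_contra hlt
    push Not at hlt
    have : g ^ 6 < 2400 ^ 6 := by gcongr
    rw [hg6] at this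
    norm_num at this hfR
    linarith
  obtain ⟨t, htdef⟩ : ∃ t, t = √(Real.log f) := ⟨_, rfl⟩
  have hlog1 : 46.4 ≤ Real.log f := by
    have h2 : Real.log ((2 : ℝ) ^ 67) ≤ Real.log f := by
      apply Real.log_le_log (by positivity)
      refine le_trans ?_ hfR
      norm_num
    rw [Real.log_pow] at h2
    have := Real.log_two_gt_d9
    push_cast at h2
    linarith
  have hlog2 : Real.log f ≤ 6 * g := by
    rw [← hg6, Real.log_pow]
    have := Real.log_le_self hgpos
    push_cast; linarith
  have ht0 : 0 ≤ t := by rw [htdef]; positivity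
  have htt : t ^ 2 = Real.log f := by rw [htdef]; exact Real.sq_sqrt (by linarith)
  have ht1 : 6.81 ≤ t := by
    rw [htdef]; apply Real.le_sqrt_of_sq_le; norm_num; linarith
  obtain ⟨X, hX⟩ : ∃ X, X = 14 * g ^ 2 * t := ⟨_, rfl⟩
  rw [hg2, ← htdef, ← hX] at hcon
  have hX0 : 0 ≤ X := by rw [hX]; positivity
  have hX1 : 95.3 * g ^ 2 ≤ X := by rw [hX]; nlinarith
  have hX2 : X ^ 2 ≤ 1176 * g ^ 5 := by
    have : X ^ 2 = 196 * g ^ 4 * t ^ 2 := by rw [hX]; ring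
    rw [this, htt]
    calc 196 * g ^ 4 * Real.log f ≤ 196 * g ^ 4 * (6 * g) := by gcongr
      _ = 1176 * g ^ 5 := by ring
  have hg56 : 2400 * g ^ 5 ≤ g ^ 6 := by
    rw [pow_succ g 5, mul_comm]; gcongr
  have hX3 : X ^ 2 < f := by
    have : 0 < g ^ 5 := by positivity
    rw [← hg6]; linarith
  have hXf : X < f := by nlinarith
  obtain ⟨H, hH⟩ : ∃ H, H = ⌊g / 2⌋₊ := ⟨_, rfl⟩
  obtain ⟨R, hR⟩ : ∃ R, R = ⌊X / 2⌋₊ := ⟨_, rfl⟩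
  obtain ⟨A, hA⟩ : ∃ A, A = R / H := ⟨_, rfl⟩
  have hH1 : (H : ℝ) ≤ g / 2 := by
    rw [hH]; exact Nat.floor_le (by positivity)
  have hH2 : g / 2 < H + 1 := by
    rw [hH]; exact Nat.lt_floor_add_one _
  have hR1 : (R : ℝ) ≤ X / 2 := by
    rw [hR]; exact Nat.floor_le (by positivity)
  have hR2 : X / 2 < R + 1 := by
    rw [hR]; exact Nat.lt_floor_add_one _
  have hHpos : 0 < H := by
    have : (0 : ℝ) < H := by linarith
    exact_mod_cast this
  have hAH : A * H ≤ R := by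
    rw [hA]; exact Nat.div_mul_le_self R H
  have hAR : A ≤ R := by
    rw [hA]; exact Nat.div_le_self R H
  have hRlt : R < (A + 1) * H := by
    rw [mul_comm, hA]; exact Nat.lt_mul_div_succ R hHpos
  have hgsq : (2400 : ℝ) * g ≤ g ^ 2 := by nlinarith
  have hRlow : 47.6 * g ^ 2 ≤ R := by nlinarith
  have hAlow : 95 * g ≤ A := by
    have h1 : (R : ℝ) < (A + 1) * H := by exact_mod_cast hRlt
    have h2 : (R : ℝ) < (A + 1) * (g / 2) := lt_of_lt_of_le h1 (by gcongr)
    have h3 : 95.2 * g * (g / 2) < (A + 1) * (g / 2) := by nlinarith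
    have h4 : 95.2 * g < A + 1 := lt_of_mul_lt_mul_right h3 (by positivity)
    linarith
  have hRf : 2 * (R : ℝ) * R < f := by nlinarith
  have hRf' : 2 * R * R < f := by exact_mod_cast hRf
  have hYX : ((2 * R : ℕ) : ℝ) ≤ X := by push_cast; linarith
  have hno : ∀ m : ℤ, |m| ≤ ((2 * R : ℕ) : ℤ) → ¬ (q₁ : ℤ) ∣ m → ¬ (q₂ : ℤ) ∣ m →
      (m : ZMod f) ≠ 0 ∧ χ (m : ZMod f) ≠ ω := by
    intro m hm h1 h2
    have hm0 : m ≠ 0 := by rintro rfl; exact h1 (dvd_zero _)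
    have hk : m.natAbs ≤ 2 * R := by
      rw [Int.abs_eq_natAbs] at hm
      exact_mod_cast hm
    have hkX : (m.natAbs : ℝ) ≤ X := le_trans (by exact_mod_cast hk) hYX
    have hkf : m.natAbs < f := by
      have : (m.natAbs : ℝ) < f := lt_of_le_of_lt hkX hXf
      exact_mod_cast this
    constructor
    · rw [Ne, ZMod.intCast_zmod_eq_zero_iff_dvd]
      intro hd
      have := Nat.le_of_dvd (by omega) (Int.natCast_dvd.1 hd)
      omega
    · intro hχm
      have hχk : χ ((m.natAbs : ℕ) : ZMod f) = ω := by
        rcases Int.natAbs_eq m with h | h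
        · rw [← hχm]; conv_rhs => rw [h]
          simp
        · rw [← hχm]; conv_rhs => rw [h]
          rw [Int.cast_neg, neg_eq_neg_one_mul, map_mul, chi_neg_one χ hχ, one_mul]
          simp
      have hc : Nat.Coprime m.natAbs (q₁ * q₂) := by
        apply Nat.Coprime.mul_right
        · exact ((Nat.Prime.coprime_iff_not_dvd hq₁p).2 fun h => h1 (Int.natCast_dvd.2 h)).symm
        · exact ((Nat.Prime.coprime_iff_not_dvd hq₂p).2 fun h => h2 (Int.natCast_dvd.2 h)).symm
      exact absurd (hcon m.natAbs (by omega) hχk hc) (not_lt.2 hkX)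
  have hHf : 2 * H + 1 < f := by
    have : (2 * H + 1 : ℝ) < f := by
      rw [← hg6]
      have : g ^ 2 ≤ g ^ 6 := pow_le_pow_right₀ (by linarith) (by norm_num)
      linarith
    exact_mod_cast this
  have hAf : A < f := by
    have := Nat.le_mul_self R
    have h2 : 2 * R * R = R * R + R * R := by ring
    omega
  have hARf : 2 * A * R < f := lt_of_le_of_lt (by gcongr) hRf'
  have hY : (R : ℤ) + A * H ≤ ((2 * R : ℕ) : ℤ) := by
    have : R + A * H ≤ 2 * R := by omega
    exact_mod_cast this
  have key := combine χ hχ (by omega) ω hω q₁ q₂ hq₁p hq₂p hq₁379 (by omega) H A R _ hno hHf hAf hARf hY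
    (by linarith)
  rw [hg3, ← hg6] at key
  exact final_numeric g hg (2 * H + 1) A R (by linarith) (by linarith) hAlow hRlow key

/-- For a prime `2×10²⁰ ≤ f ≤ 2×10⁴⁹` with smallest prime cubic non-residue `q₁ ≥ 379`,
for every primitive cube root of unity `ω` there exists a positive integer `m` with
`χ(m) = ω`, `gcd(m, q₁q₂) = 1`, and `m ≤ 14·f^{1/3}·(log f)^{1/2}`. -/
theorem exists_nonresidue_q1_ge_379 (f : ℕ) (hf : f.Prime)
    (hf1 : 2 * 10 ^ 20 ≤ f) (hf2 : f ≤ 2 * 10 ^ 49)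
    (χ : DirichletCharacter ℂ f) (hχ : orderOf χ = 3)
    (q₁ q₂ : ℕ) (hq₁p : q₁.Prime)
    (hq₁nr : χ (q₁ : ZMod f) ≠ 0 ∧ χ (q₁ : ZMod f) ≠ 1)
    (hq₁min : ∀ p : ℕ, p.Prime → p < q₁ → χ (p : ZMod f) = 0 ∨ χ (p : ZMod f) = 1)
    (hq₁₂ : q₁ < q₂) (hq₂p : q₂.Prime)
    (hq₂nr : χ (q₂ : ZMod f) ≠ 0 ∧ χ (q₂ : ZMod f) ≠ 1)
    (hq₂min : ∀ p : ℕ, p.Prime → q₁ < p → p < q₂ → χ (p : ZMod f) = 0 ∨ χ (p : ZMod f) = 1)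
    (hq₁379 : 379 ≤ q₁)
    (ω : ℂ) (hω : ω ^ 3 = 1) (hω1 : ω ≠ 1) :
    ∃ m : ℕ, 0 < m ∧ χ (m : ZMod f) = ω ∧ Nat.Coprime m (q₁ * q₂) ∧
      (m : ℝ) ≤ 14 * (f : ℝ) ^ ((1 : ℝ) / 3) * Real.sqrt (Real.log f) := by
  exact main_aux f hf hf1 χ hχ q₁ q₂ hq₁p hq₁₂ hq₂p hq₁379 ω hω
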